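/- arXiv:2301.09022 — 4 statements merged into one kernel-verified Lean document; each statement's English description precedes it below -/
import Mathlib

section
/- Let 0 < b < a, let Ω = {(x,y) ∈ ℝ² : x²/a² + y²/b² < 1}, and let ξ = (a·cos t₀, b·sin t₀) with t₀ ∈ (0, π/2) be a boundary point of Ω in the open first quadrant. Let ℓ be the normal line to the ellipse at ξ, i.e. the line through ξ with direction (cos t₀ / a, sin t₀ / b), and let T₋ be the open half-plane bounded by ℓ that contains the vertex (a, 0). Then the reflection across the line ℓ maps Ω ∩ T₋ into Ω. -/
/-- In the orthogonal frame `(d₁, d₂)`, `(d₂, -d₁)` at a boundary point `(x, y)` of the ellipse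
`A x² + B y² = 1`, with `d = (A x, B y)` the normal, a point with coordinates `(u, v)` inside the
ellipse and `0 < v` reflects to the point with coordinates `(u, -v)`, again inside the ellipse. -/
theorem ellipse_reflect_normal_frame {A B x y u v : ℝ} (hA : 0 < A) (hAB : A < B)
    (hx : 0 < x) (hy : 0 < y) (hxy : A * x ^ 2 + B * y ^ 2 = 1) (hv : 0 < v)
    (h : A * (x + (u * (A * x) + v * (B * y))) ^ 2
      + B * (y + (u * (B * y) - v * (A * x))) ^ 2 < 1) :
    A * (x + (u * (A * x) - v * (B * y))) ^ 2
      + B * (y + (u * (B * y) + v * (A * x))) ^ 2 < 1 := by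
  have hB : 0 < B := hA.trans hAB
  have hN : 0 < (A * x) ^ 2 + (B * y) ^ 2 := by positivity
  have hq : 0 ≤ A * (u * (A * x) + v * (B * y)) ^ 2 + B * (u * (B * y) - v * (A * x)) ^ 2 := by
    positivity
  have hu : u < 0 := by
    have : u * ((A * x) ^ 2 + (B * y) ^ 2) < 0 := by linarith
    exact neg_of_mul_neg_left this hN.le
  have hpos : 0 < -u * v * ((A * x) * (B * y)) * (B - A) :=
    mul_pos (mul_pos (mul_pos (neg_pos.2 hu) hv) (by positivity)) (sub_pos.2 hAB)
  linarith

/-- For the ellipse `x²/a² + y²/b² = 1` with `0 < b < a`, reflection across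
the normal line `ℓ` at a boundary point `ξ = (a cos t₀, b sin t₀)` (with `t₀ ∈ (0, π/2)`)
maps `Ω ∩ T₋` into `Ω`, where `T₋` is the open half-plane bounded by `ℓ` containing the
vertex `(a, 0)`.  The normal direction at `ξ` is `d = (cos t₀ / a, sin t₀ / b)`, the
reflection of `p` across `ℓ` is `ξ + 2·(⟨p−ξ,d⟩/⟨d,d⟩)·d − (p−ξ)`, and `T₋` consists of the
points `p` such that the cross product `(p−ξ) × d` has the same (strict) sign as
`((a,0)−ξ) × d`. -/
theorem ellipse_reflection_in_normal (a b : ℝ) (hb : 0 < b) (hab : b < a)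
    (t₀ : ℝ) (ht₀ : t₀ ∈ Set.Ioo 0 (Real.pi / 2))
    (Ω : Set (ℝ × ℝ)) (hΩ : Ω = {p : ℝ × ℝ | p.1 ^ 2 / a ^ 2 + p.2 ^ 2 / b ^ 2 < 1})
    (ξ : ℝ × ℝ) (hξ : ξ = (a * Real.cos t₀, b * Real.sin t₀))
    (d : ℝ × ℝ) (hd : d = (Real.cos t₀ / a, Real.sin t₀ / b))
    (refl : ℝ × ℝ → ℝ × ℝ)
    (hrefl : ∀ p : ℝ × ℝ,
      refl p =
        (ξ.1 + (2 * ((p.1 - ξ.1) * d.1 + (p.2 - ξ.2) * d.2) / (d.1 ^ 2 + d.2 ^ 2)) * d.1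
            - (p.1 - ξ.1),
          ξ.2 + (2 * ((p.1 - ξ.1) * d.1 + (p.2 - ξ.2) * d.2) / (d.1 ^ 2 + d.2 ^ 2)) * d.2
            - (p.2 - ξ.2)))
    (Tm : Set (ℝ × ℝ))
    (hTm : Tm = {p : ℝ × ℝ |
      0 < ((p.1 - ξ.1) * d.2 - (p.2 - ξ.2) * d.1) * ((a - ξ.1) * d.2 - (0 - ξ.2) * d.1)}) :
    ∀ p ∈ Ω ∩ Tm, refl p ∈ Ω := by
  subst hΩ hξ hd hTm
  rintro ⟨p₁, p₂⟩ ⟨hp, hT⟩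
  have ha : 0 < a := hb.trans hab
  have hs : 0 < Real.sin t₀ := Real.sin_pos_of_pos_of_lt_pi ht₀.1 (by linarith [ht₀.2, Real.pi_pos])
  have hc : 0 < Real.cos t₀ := Real.cos_pos_of_mem_Ioo ⟨by linarith [ht₀.1, Real.pi_pos], ht₀.2⟩
  have hcs := Real.cos_sq_add_sin_sq t₀
  have hc1 := Real.cos_le_one t₀
  rw [hrefl]
  simp only [Set.mem_ofPred_eq] at hp hT ⊢
  generalize Real.cos t₀ = c at *
  generalize Real.sin t₀ = s at *
  have hA : 0 < 1 / a ^ 2 := by positivity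
  have hAB : 1 / a ^ 2 < 1 / b ^ 2 := by gcongr
  have hd₁ : 1 / a ^ 2 * (a * c) = c / a := by field_simp
  have hd₂ : 1 / b ^ 2 * (b * s) = s / b := by field_simp
  have hvertex : 0 < (a - a * c) * (s / b) - (0 - b * s) * (c / a) := by
    have h₁ : 0 ≤ a * (1 - c) * (s / b) := by
      have := sub_nonneg.2 hc1
      positivity
    have h₂ : 0 < b * s * (c / a) := by positivity
    linarith
  have hcross := pos_of_mul_pos_left hT hvertex.le
  have hd₁_pos : 0 < c / a := by positivity
  have hd₂_pos : 0 < s / b := by positivity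
  have hbdry : 1 / a ^ 2 * (a * c) ^ 2 + 1 / b ^ 2 * (b * s) ^ 2 = 1 := by
    field_simp
    exact hcs
  have key := fun u v => ellipse_reflect_normal_frame (u := u) (v := v) hA hAB
    (mul_pos ha hc) (mul_pos hb hs) hbdry
  rw [hd₁, hd₂] at key
  generalize c / a = d₁ at *
  generalize s / b = d₂ at *
  have hN : 0 < d₁ ^ 2 + d₂ ^ 2 := by positivity
  have := key (((p₁ - a * c) * d₁ + (p₂ - b * s) * d₂) / (d₁ ^ 2 + d₂ ^ 2))
    (((p₁ - a * c) * d₂ - (p₂ - b * s) * d₁) / (d₁ ^ 2 + d₂ ^ 2)) (div_pos hcross hN)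
  simp only [one_div_mul_eq_div] at this
  convert this ?_ using 5
  · field_simp
    ring
  · field_simp
    ring
  · convert hp using 4
    · field_simp
      ring
    · field_simp
      ring
end

section
/- Let γ : ℝ → ℝ² be a twice continuously differentiable unit-speed curve and set n(s) = (γ'(s)₂, −γ'(s)₁), the unit normal obtained by rotating the tangent γ'(s) clockwise by a right angle. Let s₀ ∈ ℝ and let v be a real-valued C² function on a neighborhood of γ(s₀). Assume: (i) v(γ(s)) = 0 for all s in a neighborhood of s₀; and (ii) there exists ε₀ > 0 such that ⟨∇v(γ(s₀) − ε·n(s₀)), γ'(s₀)⟩ ≥ 0 for all ε ∈ (0, ε₀). Then the function s ↦ −⟨∇v(γ(s)), n(s)⟩ has nonnegative derivative at s = s₀. -/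
open RealInnerProductSpace

/-- A point of the Euclidean plane with given coordinates. -/
noncomputable def vec2 (x y : ℝ) : EuclideanSpace ℝ (Fin 2) :=
  (WithLp.equiv 2 (Fin 2 → ℝ)).symm ![x, y]

theorem inner_gradient_eq_fderiv {E : Type*} [NormedAddCommGroup E] [InnerProductSpace ℝ E]
    [CompleteSpace E] (f : E → ℝ) (x y : E) : ⟪gradient f x, y⟫ = fderiv ℝ f x y := by
  simp [gradient]

theorem HasDerivAt.vec2 {f g : ℝ → ℝ} {f' g' s : ℝ} (hf : HasDerivAt f f' s)
    (hg : HasDerivAt g g' s) : HasDerivAt (fun t => vec2 (f t) (g t)) (vec2 f' g') s := by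
  have h : HasDerivAt (fun t => ![f t, g t]) ![f', g'] s := by
    rw [hasDerivAt_pi]
    intro i
    fin_cases i
    · exact hf
    · exact hg
  exact (EuclideanSpace.equiv (Fin 2) ℝ).symm.hasFDerivAt.comp_hasDerivAt s h

/-- A vector orthogonal to a unit vector `u` of the plane becomes parallel to `u` after a
quarter turn. -/
theorem vec2_rotate_eq_smul_of_inner_eq_zero {u w : EuclideanSpace ℝ (Fin 2)} (hu : ‖u‖ = 1)
    (h : ⟪u, w⟫ = 0) : vec2 (w 1) (-(w 0)) = (w 1 * u 0 - w 0 * u 1) • u := by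
  have h1 : u 0 ^ 2 + u 1 ^ 2 = 1 := by
    have := EuclideanSpace.real_norm_sq_eq u
    rw [hu, Fin.sum_univ_two] at this
    linarith
  have h2 : u 0 * w 0 + u 1 * w 1 = 0 := by
    simp only [PiLp.inner_apply, Fin.sum_univ_two, RCLike.inner_apply, conj_trivial] at h
    linarith
  ext i
  fin_cases i
  · simp [vec2]
    linear_combination (-w 1) * h1 + u 1 * h2
  · simp [vec2]
    linear_combination (w 0) * h1 - u 0 * h2

/-- The derivative of a function with a right minimum is nonnegative. -/
theorem HasDerivAt.nonneg_of_forall_Ioo_le {g : ℝ → ℝ} {d a b : ℝ} (hg : HasDerivAt g d a)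
    (hab : a < b) (h : ∀ t ∈ Set.Ioo a b, g a ≤ g t) : 0 ≤ d := by
  have hlim := (hasDerivAt_iff_tendsto_slope.1 hg).mono_left
    (nhdsWithin_mono a (fun t (ht : t ∈ Set.Ioi a) => ne_of_gt ht))
  refine ge_of_tendsto hlim ?_
  filter_upwards [Ioo_mem_nhdsGT hab] with t ht
  rw [slope_def_field]
  exact div_nonneg (sub_nonneg.2 (h t ht)) (sub_nonneg.2 ht.1.le)

/-- Let `γ` be a `C²` unit-speed plane curve, `n(s) = (γ'(s)₂, −γ'(s)₁)` the
clockwise-rotated unit normal, and `v` a `C²` function near `γ(s₀)` vanishing along `γ`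
near `s₀`.  If `⟨∇v(γ(s₀) − ε·n(s₀)), γ'(s₀)⟩ ≥ 0` for all small `ε > 0`, then the inward
normal derivative `s ↦ −⟨∇v(γ(s)), n(s)⟩` has nonnegative derivative at `s₀`. -/
theorem boundary_speed_monotone
    (γ : ℝ → EuclideanSpace ℝ (Fin 2)) (hγ : ContDiff ℝ 2 γ)
    (hunit : ∀ s, ‖deriv γ s‖ = 1)
    (n : ℝ → EuclideanSpace ℝ (Fin 2))
    (hn : ∀ s, n s = vec2 (deriv γ s 1) (-(deriv γ s 0)))
    (s₀ : ℝ) (v : EuclideanSpace ℝ (Fin 2) → ℝ)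
    (hv : ContDiffAt ℝ 2 v (γ s₀))
    (hzero : ∀ᶠ s in nhds s₀, v (γ s) = 0)
    (ε₀ : ℝ) (hε₀ : 0 < ε₀)
    (hrefl : ∀ ε ∈ Set.Ioo (0 : ℝ) ε₀, 0 ≤ ⟪gradient v (γ s₀ - ε • n s₀), deriv γ s₀⟫) :
    ∃ d : ℝ, HasDerivAt (fun s => -⟪gradient v (γ s), n s⟫) d s₀ ∧ 0 ≤ d := by
  simp only [inner_gradient_eq_fderiv] at hrefl ⊢
  have hγ₁ : HasDerivAt γ (deriv γ s₀) s₀ :=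
    (hγ.differentiable (by norm_num) s₀).hasDerivAt
  have hγ₂ : HasDerivAt (deriv γ) (deriv (deriv γ) s₀) s₀ := by
    have h : ContDiff ℝ (1 + 1) γ := by simpa [one_add_one_eq_two] using hγ
    exact ((contDiff_succ_iff_deriv.1 h).2.2.differentiable (by norm_num) s₀).hasDerivAt
  have hDv : HasFDerivAt (fderiv ℝ v) (fderiv ℝ (fderiv ℝ v) (γ s₀)) (γ s₀) :=
    ((hv.fderiv_right (m := 1) (by norm_num [one_add_one_eq_two])).differentiableAt
      (by norm_num)).hasFDerivAt
  have hsymm : IsSymmSndFDerivAt ℝ v (γ s₀) := hv.isSymmSndFDerivAt (by simp)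
  have htan : fderiv ℝ v (γ s₀) (deriv γ s₀) = 0 :=
    ((hv.differentiableAt (by norm_num)).hasFDerivAt.comp_hasDerivAt s₀ hγ₁).unique
      ((hasDerivAt_const s₀ (0 : ℝ)).congr_of_eventuallyEq hzero)
  have horth : ⟪deriv γ s₀, deriv (deriv γ) s₀⟫ = 0 := by
    have h := hγ₂.norm_sq
    simp only [hunit] at h
    have := h.unique (hasDerivAt_const s₀ _)
    linarith
  have hcoord (i : Fin 2) : HasDerivAt (fun s => deriv γ s i) (deriv (deriv γ) s₀ i) s₀ :=
    (EuclideanSpace.proj (𝕜 := ℝ) i).hasFDerivAt.comp_hasDerivAt s₀ hγ₂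
  have hn' : HasDerivAt n
      (vec2 (deriv (deriv γ) s₀ 1) (-(deriv (deriv γ) s₀ 0))) s₀ := by
    rw [funext hn]
    exact (hcoord 1).vec2 (hcoord 0).neg
  rw [vec2_rotate_eq_smul_of_inner_eq_zero (hunit s₀) horth] at hn'
  refine ⟨_, ((hDv.comp_hasDerivAt s₀ hγ₁).clm_apply hn').neg, ?_⟩
  have hline : HasDerivAt (fun ε : ℝ => γ s₀ - ε • n s₀) (-n s₀) 0 := by
    simpa using ((hasDerivAt_id (0 : ℝ)).smul_const (n s₀)).const_sub (γ s₀)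
  have hnormal : HasDerivAt (fun ε : ℝ => fderiv ℝ v (γ s₀ - ε • n s₀) (deriv γ s₀))
      (fderiv ℝ (fderiv ℝ v) (γ s₀) (-n s₀) (deriv γ s₀)) 0 := by
    have hDv' : HasFDerivAt (fderiv ℝ v) (fderiv ℝ (fderiv ℝ v) (γ s₀))
        (γ s₀ - (0 : ℝ) • n s₀) := by simpa using hDv
    have hcomp : HasDerivAt (fun ε : ℝ => fderiv ℝ v (γ s₀ - ε • n s₀))
        (fderiv ℝ (fderiv ℝ v) (γ s₀) (-n s₀)) 0 :=
      hDv'.comp_hasDerivAt (f := fun ε : ℝ => γ s₀ - ε • n s₀) 0 hline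
    exact (ContinuousLinearMap.apply ℝ ℝ (deriv γ s₀)).hasFDerivAt.comp_hasDerivAt 0 hcomp
  have hnonneg := hnormal.nonneg_of_forall_Ioo_le hε₀ (fun t ht => by
    simpa [htan] using hrefl t ht)
  simpa [htan, hsymm.eq (deriv γ s₀) (n s₀)] using hnonneg
end

section
/- Let p > 2, set a = (p−2)/(p−1), and let c ∈ ℝ², ε > 0, M ≥ 0, and let n ∈ ℝ² be a unit vector. Put ξ = c + ε·n and define the barrier w(x) = M·(ε^a − ‖x − c‖^a)/ε^a. Let u : ℝ² → ℝ be differentiable at ξ with u(ξ) = 0, and suppose u(ξ − h·n) ≥ w(ξ − h·n) for all h ∈ (0, ε). Then −⟨∇u(ξ), n⟩ ≥ ((p−2)/(p−1))·M/ε. -/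
open RealInnerProductSpace

/-- A function that is eventually at least its value at `x` on the right of `x` has nonnegative
derivative at `x`. -/
theorem HasDerivAt.nonneg_of_eventually_ge_right {f : ℝ → ℝ} {f' x : ℝ} (hf : HasDerivAt f f' x)
    (h : ∀ᶠ y in nhdsWithin x (Set.Ioi x), f x ≤ f y) : 0 ≤ f' := by
  have hslope : Filter.Tendsto (slope f x) (nhdsWithin x (Set.Ioi x)) (nhds f') :=
    (hasDerivWithinAt_iff_tendsto_slope' Set.self_notMem_Ioi).1 hf.hasDerivWithinAt
  refine ge_of_tendsto hslope ?_
  filter_upwards [h, self_mem_nhdsWithin] with y hy hxy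
  rw [slope_def_field]
  exact div_nonneg (sub_nonneg.2 hy) (sub_nonneg.2 (le_of_lt hxy))

/-- The radial profile of the barrier, read off inward from the circle of radius `ε`, has slope
`a * M / ε` at the boundary. -/
theorem hasDerivAt_barrier_profile (a M : ℝ) {ε : ℝ} (hε : 0 < ε) :
    HasDerivAt (fun h : ℝ => M * (ε ^ a - (ε - h) ^ a) / ε ^ a) (a * M / ε) 0 := by
  have hlin : HasDerivAt (fun h : ℝ => ε - h) (-1) 0 := (hasDerivAt_id 0).const_sub ε
  have hpow : HasDerivAt (fun h : ℝ => (ε - h) ^ a) (-1 * a * (ε - 0) ^ (a - 1)) 0 :=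
    hlin.rpow_const (Or.inl (by simpa using hε.ne'))
  refine (((hpow.const_sub (ε ^ a)).const_mul M).div_const (ε ^ a)).congr_deriv ?_
  have hεa : ε ^ a ≠ 0 := (Real.rpow_pos_of_pos hε a).ne'
  rw [sub_zero, Real.rpow_sub_one hε.ne']
  field_simp

/-- The derivative of `u` along the line `h ↦ ξ - h • n`. -/
theorem DifferentiableAt.hasDerivAt_comp_sub_smul {E : Type*} [NormedAddCommGroup E]
    [InnerProductSpace ℝ E] [CompleteSpace E] {u : E → ℝ} {ξ : E} (hu : DifferentiableAt ℝ u ξ)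
    (n : E) : HasDerivAt (fun h : ℝ => u (ξ - h • n)) (-⟪gradient u ξ, n⟫) 0 := by
  have hline : HasDerivAt (fun h : ℝ => ξ - h • n) (-n) 0 := by
    simpa using ((hasDerivAt_id (0 : ℝ)).smul_const n).const_sub ξ
  have hgrad : HasFDerivAt u (InnerProductSpace.toDual ℝ E (gradient u ξ)) (ξ - (0 : ℝ) • n) := by
    simpa using hu.hasGradientAt.hasFDerivAt
  simpa [Function.comp_def] using hgrad.comp_hasDerivAt (0 : ℝ) hline

/-- Barrier estimate.  Let `p > 2`, `a = (p−2)/(p−1)`, let `w` be the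
fundamental-solution barrier `w(x) = M·(ε^a − ‖x−c‖^a)/ε^a` in the disk of radius `ε`
centered at `c`, and let `ξ = c + ε·n` with `‖n‖ = 1`.  If `u` is differentiable at `ξ`,
`u(ξ) = 0`, and `u ≥ w` along the inward normal segment, then
`−⟨∇u(ξ), n⟩ ≥ ((p−2)/(p−1))·M/ε`. -/
theorem barrier_normal_derivative_estimate (p : ℝ) (hp : 2 < p)
    (a : ℝ) (ha : a = (p - 2) / (p - 1))
    (c : EuclideanSpace ℝ (Fin 2)) (ε M : ℝ) (hε : 0 < ε) (hM : 0 ≤ M)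
    (n : EuclideanSpace ℝ (Fin 2)) (hn : ‖n‖ = 1)
    (ξ : EuclideanSpace ℝ (Fin 2)) (hξ : ξ = c + ε • n)
    (w : EuclideanSpace ℝ (Fin 2) → ℝ)
    (hw : ∀ x, w x = M * (ε ^ a - ‖x - c‖ ^ a) / ε ^ a)
    (u : EuclideanSpace ℝ (Fin 2) → ℝ)
    (hu : DifferentiableAt ℝ u ξ) (huξ : u ξ = 0)
    (hbar : ∀ h ∈ Set.Ioo (0 : ℝ) ε, u (ξ - h • n) ≥ w (ξ - h • n)) :
    -⟪gradient u ξ, n⟫ ≥ ((p - 2) / (p - 1)) * M / ε := by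
  have hderiv := (hu.hasDerivAt_comp_sub_smul n).sub (hasDerivAt_barrier_profile a M hε)
  have hnonneg := hderiv.nonneg_of_eventually_ge_right (by
    filter_upwards [Ioo_mem_nhdsGT hε] with h hh
    have hnorm : ‖ξ - h • n - c‖ = ε - h := by
      have hvec : ξ - h • n - c = (ε - h) • n := by rw [hξ]; module
      rw [hvec, norm_smul, hn, mul_one, Real.norm_of_nonneg (sub_nonneg.2 hh.2.le)]
    have hle := hbar h hh
    rw [hw, hnorm] at hle
    simpa [huξ] using hle)
  rw [← ha]
  linarith
end

section
/- Set m_n = 4n − 2 for n ≥ 1 and let ρ = 0.97 = 97/100. Then (8/π)·Σ_{n≥1} (−1)^{n−1}·ρ^{m_n²−1}/m_n > 1, where the series converges absolutely. In particular, (8/π)·( (1/2)·(0.97)³ − (1/6)·(0.97)³⁵ ) > 1. -/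
/-- `m n = 4(n+1) − 2`, i.e. the sequence `m_k = 4k − 2`, `k ≥ 1`, indexed from `n = 0`. -/
def m (n : ℕ) : ℕ := 4 * (n + 1) - 2

theorem m_eq (n : ℕ) : m n = 4 * n + 2 := by
  unfold m
  omega

/-- The absolute values of the terms are dominated by a geometric series. -/
theorem pow_div_m_le_pow {r : ℝ} (h0 : 0 ≤ r) (h1 : r ≤ 1) (n : ℕ) :
    r ^ (m n ^ 2 - 1) / (m n : ℝ) ≤ r ^ n := by
  have hm : (1 : ℝ) ≤ m n := by
    rw [m_eq]
    exact_mod_cast (by omega : 1 ≤ 4 * n + 2)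
  have hn : n ≤ m n ^ 2 - 1 := by
    rw [m_eq]
    exact Nat.le_sub_of_add_le (by nlinarith)
  exact (div_le_self (pow_nonneg h0 _) hm).trans (pow_le_pow_of_le_one h0 h1 hn)

theorem antitone_pow_div_m {r : ℝ} (h0 : 0 ≤ r) (h1 : r ≤ 1) :
    Antitone fun n : ℕ => r ^ (m n ^ 2 - 1) / (m n : ℝ) := by
  intro a b hab
  have hm : m a ≤ m b := by
    simp only [m_eq]
    omega
  have hpos : (0 : ℝ) < m a := by
    rw [m_eq]
    positivity
  have hexp : m a ^ 2 - 1 ≤ m b ^ 2 - 1 := Nat.sub_le_sub_right (Nat.pow_le_pow_left hm 2) 1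
  exact div_le_div₀ (pow_nonneg h0 _) (pow_le_pow_of_le_one h0 h1 hexp) hpos
    (by exact_mod_cast hm)

theorem summable_abs_alternating_pow_div_m {r : ℝ} (h0 : 0 ≤ r) (h1 : r < 1) :
    Summable fun n : ℕ => |(-1 : ℝ) ^ n * r ^ (m n ^ 2 - 1) / (m n : ℝ)| := by
  refine Summable.of_nonneg_of_le (fun n => abs_nonneg _) (fun n => ?_)
    (summable_geometric_of_lt_one h0 h1)
  rw [mul_div_assoc, abs_mul, abs_pow, abs_neg, abs_one, one_pow, one_mul,
    abs_of_nonneg (by positivity)]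
  exact pow_div_m_le_pow h0 h1.le n

/-- The alternating series is bounded below by its first two terms. -/
theorem first_two_terms_le_tsum {r : ℝ} (h0 : 0 ≤ r) (h1 : r < 1) :
    1 / 2 * r ^ 3 - 1 / 6 * r ^ 35 ≤
      ∑' n : ℕ, (-1 : ℝ) ^ n * r ^ (m n ^ 2 - 1) / (m n : ℝ) := by
  have hsum := (summable_abs_alternating_pow_div_m h0 h1).of_abs.hasSum.tendsto_sum_nat
  simp only [mul_div_assoc] at hsum ⊢
  have h := (antitone_pow_div_m h0 h1.le).alternating_series_le_tendsto hsum 1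
  norm_num [Finset.sum_range_succ, m_eq] at h
  simp only [m_eq]
  push_cast
  linarith

theorem one_lt_first_two_terms :
    1 < 8 / Real.pi * (1 / 2 * (97 / 100 : ℝ) ^ 3 - 1 / 6 * (97 / 100 : ℝ) ^ 35) := by
  rw [div_mul_eq_mul_div, lt_div_iff₀ Real.pi_pos, one_mul]
  exact Real.pi_lt_d2.trans (by norm_num)

/-- At `ρ = 0.97 = 97/100` the reciprocal Rayleigh quotient
`(8/π)·Σ (−1)^{n−1}·ρ^{m_n²−1}/m_n` (with `m_n = 4n − 2`) exceeds `1`, the series being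
absolutely convergent; in particular `(8/π)·((1/2)·0.97³ − (1/6)·0.97³⁵) > 1`. -/
theorem reciprocal_rayleigh_gt_one (ρ : ℝ) (hρ : ρ = 97 / 100) :
    (Summable fun n : ℕ => |(-1 : ℝ) ^ n * ρ ^ (m n ^ 2 - 1) / (m n : ℝ)|) ∧
    1 < 8 / Real.pi * ∑' n : ℕ, (-1 : ℝ) ^ n * ρ ^ (m n ^ 2 - 1) / (m n : ℝ) ∧
    1 < 8 / Real.pi *
        (1 / 2 * (97 / 100 : ℝ) ^ 3 - 1 / 6 * (97 / 100 : ℝ) ^ 35) := by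
  have h0 : 0 ≤ ρ := by norm_num [hρ]
  have h1 : ρ < 1 := by norm_num [hρ]
  refine ⟨summable_abs_alternating_pow_div_m h0 h1, ?_, one_lt_first_two_terms⟩
  refine one_lt_first_two_terms.trans_le ?_
  rw [← hρ]
  exact mul_le_mul_of_nonneg_left (first_two_terms_le_tsum h0 h1) (by positivity)
end
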